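/- If φ : [0,T] × 𝒫₂ → ℝ satisfies condition (A3), then for all (t,m) ∈ [0,T) × 𝒫₂ the map s ↦ φ(s, p^{t,m}_s) is right-differentiable at s = t with lim_{s↓t} (φ(s, p^{t,m}_s) − φ(t,m))/(s−t) = ∂_t φ(t,m) + (1/2) ∫_{ℝ^d} div[D_m φ](t,m,x) dm(x). -/

import Mathlib

open MeasureTheory Filter Set
open scoped Topology ENNReal NNReal BoundedContinuousFunction

noncomputable section

/-- Euclidean space `ℝ^d`. -/
abbrev Ed (d : ℕ) : Type := EuclideanSpace ℝ (Fin d)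

/-- `m ∈ 𝒫_p` : Borel probability measure on `ℝ^d` with finite `p`-th moment. -/
def MemP (d : ℕ) (p : ℝ) (m : Measure (Ed d)) : Prop :=
  IsProbabilityMeasure m ∧ Integrable (fun x => ‖x‖ ^ p) m

/-- `γ` is a coupling of `m` and `m'`. -/
def IsCoupling (d : ℕ) (γ : Measure (Ed d × Ed d)) (m m' : Measure (Ed d)) : Prop :=
  γ.map Prod.fst = m ∧ γ.map Prod.snd = m'

/-- The `p`-Wasserstein distance. -/
def wdist (d : ℕ) (p : ℝ) (m m' : Measure (Ed d)) : ℝ :=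
  sInf { c : ℝ | ∃ γ : Measure (Ed d × Ed d), IsProbabilityMeasure γ ∧ IsCoupling d γ m m' ∧
      c = (∫ q, ‖q.1 - q.2‖ ^ p ∂γ) ^ (1 / p) }

/-- The Gaussian kernel `ρ_δ`. -/
def gaussDensity (d : ℕ) (δ : ℝ) (x : Ed d) : ℝ :=
  (2 * Real.pi * δ) ^ (-(d : ℝ) / 2) * Real.exp (-‖x‖ ^ 2 / (2 * δ))

/-- The centered Gaussian measure with variance `δ` on `ℝ^d`. -/
def gaussMeasure (d : ℕ) (δ : ℝ) : Measure (Ed d) :=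
  volume.withDensity fun x => ENNReal.ofReal (gaussDensity d δ x)

/-- The heat flow `p^{t,m}_s` : the law at time `s` of a Brownian motion started
at time `t` with initial law `m`. -/
def heatFlow (d : ℕ) (t s : ℝ) (m : Measure (Ed d)) : Measure (Ed d) :=
  if s ≤ t then m
  else Measure.map (fun q : Ed d × Ed d => q.1 + q.2) (m.prod (gaussMeasure d (s - t)))

/-- The Laplacian of a function on `ℝ^d` (the spatial divergence of its gradient),
`div[∇g](x) = Σ_i ∂²g/∂x_i²(x)`. -/
def lapl (d : ℕ) (g : Ed d → ℝ) (x : Ed d) : ℝ :=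
  ∑ i : Fin d, iteratedFDeriv ℝ 2 g x (fun _ => EuclideanSpace.single i (1:ℝ))

/-- A test function satisfying condition (A3): `φ` is lower semicontinuous (for `d₁`) and
`d₂`-continuous, the derivatives `∂φ/∂t`, `δφ/δm`, `∇_x(δφ/δm)`, `∇²_x(δφ/δm)` exist and
are `d₂`-continuous on `[0,T) × 𝒫₂ × ℝ^d`, and `δφ/δm` and its first and second spatial
derivatives have at most quadratic growth in `x`, uniformly in `(t,m)`. -/
structure TestFn (d : ℕ) (T : ℝ) where
  /-- the test function `φ(t,m)` -/
  φ : ℝ → Measure (Ed d) → ℝ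
  /-- the time derivative `∂φ/∂t` -/
  φt : ℝ → Measure (Ed d) → ℝ
  /-- the linear functional derivative `δφ/δm (t,m,x)` -/
  δφ : ℝ → Measure (Ed d) → Ed d → ℝ
  lsc : ∀ t ∈ Set.Icc 0 T, ∀ m : Measure (Ed d), MemP d 2 m → ∀ ε > (0:ℝ), ∃ η > (0:ℝ),
    ∀ t' ∈ Set.Icc 0 T, ∀ m' : Measure (Ed d), MemP d 2 m' →
      |t' - t| < η → wdist d 1 m m' < η → φ t m - ε < φ t' m'
  d2cont : ∀ t ∈ Set.Icc 0 T, ∀ m : Measure (Ed d), MemP d 2 m → ∀ ε > (0:ℝ), ∃ η > (0:ℝ),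
    ∀ t' ∈ Set.Icc 0 T, ∀ m' : Measure (Ed d), MemP d 2 m' →
      |t' - t| < η → wdist d 2 m m' < η → |φ t' m' - φ t m| < ε
  timeDeriv : ∀ m : Measure (Ed d), MemP d 2 m → ∀ t ∈ Set.Ico 0 T,
    HasDerivWithinAt (fun s => φ s m) (φt t m) (Set.Icc 0 T) t
  measDeriv : ∀ t ∈ Set.Ico 0 T, ∀ m : Measure (Ed d), MemP d 2 m →
    ∀ m' : Measure (Ed d), MemP d 2 m' →
      Tendsto (fun r : ℝ =>
          (φ t ((1 - ENNReal.ofReal r) • m + ENNReal.ofReal r • m') - φ t m) / r)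
        (𝓝[>] 0) (𝓝 (∫ x, δφ t m x ∂m'))
  normalized : ∀ t ∈ Set.Ico 0 T, ∀ m : Measure (Ed d), MemP d 2 m →
    ∫ x, δφ t m x ∂m = 0
  smoothX : ∀ t ∈ Set.Ico 0 T, ∀ m : Measure (Ed d), MemP d 2 m → ContDiff ℝ 2 (δφ t m)
  quadGrowth : ∃ c : ℝ, ∀ t ∈ Set.Ico 0 T, ∀ m : Measure (Ed d), MemP d 2 m → ∀ x : Ed d,
    |δφ t m x| ≤ c * (1 + ‖x‖ ^ 2) ∧ ‖fderiv ℝ (δφ t m) x‖ ≤ c * (1 + ‖x‖ ^ 2) ∧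
      ‖iteratedFDeriv ℝ 2 (δφ t m) x‖ ≤ c * (1 + ‖x‖ ^ 2)
  d2contDeriv : ∀ t ∈ Set.Ico 0 T, ∀ m : Measure (Ed d), MemP d 2 m → ∀ x : Ed d,
    ∀ ε > (0:ℝ), ∃ η > (0:ℝ), ∀ t' ∈ Set.Ico 0 T, ∀ m' : Measure (Ed d), MemP d 2 m' →
      ∀ x' : Ed d, |t' - t| < η → wdist d 2 m m' < η → ‖x' - x‖ < η →
        |φt t' m' - φt t m| < ε ∧ |δφ t' m' x' - δφ t m x| < ε ∧
          ‖fderiv ℝ (δφ t' m') x' - fderiv ℝ (δφ t m) x‖ < ε ∧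
          ‖iteratedFDeriv ℝ 2 (δφ t' m') x' - iteratedFDeriv ℝ 2 (δφ t m) x‖ < ε

/-- `φ − u` has a local minimum at `(t,m)` (locality for `|·|` in time and `d₁` in measure). -/
def LocalMinAt (d : ℕ) (T : ℝ) (g : ℝ → Measure (Ed d) → ℝ)
    (t : ℝ) (m : Measure (Ed d)) : Prop :=
  ∃ η > (0:ℝ), ∀ t' ∈ Set.Icc 0 T, ∀ m' : Measure (Ed d), MemP d 2 m' →
    |t' - t| ≤ η → wdist d 1 m m' ≤ η → g t m ≤ g t' m'

/-- `u` is a (viscosity) subsolution on `[0,T) × 𝒫₂` of the Hamilton-Jacobi equation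
`∂_t U(t,m) + ½ ∫ div[D_m U](t,m,x) dm(x) + F(t,m) = 0` : for every `(t,m) ∈ [0,T) × 𝒫₂`
and every test function `φ` satisfying (A3) such that `φ − u` has a local minimum at
`(t,m)`, one has `∂_t φ(t,m) + ½ ∫ div[D_m φ](t,m,x) dm(x) + F(t,m) ≥ 0`. -/
def IsSubsolution (d : ℕ) (T : ℝ) (F : ℝ → Measure (Ed d) → ℝ)
    (u : ℝ → Measure (Ed d) → ℝ) : Prop :=
  ∀ t ∈ Set.Ico 0 T, ∀ m : Measure (Ed d), MemP d 2 m → ∀ ψ : TestFn d T,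
    LocalMinAt d T (fun s μ => ψ.φ s μ - u s μ) t m →
      ψ.φt t m + (1 / 2) * (∫ x, lapl d (ψ.δφ t m) x ∂m) + F t m ≥ 0

/-- `u : [0,T] × 𝒫₂ → ℝ` is (jointly) continuous for the distance `|·| + d₁`. -/
def ContD1 (d : ℕ) (T : ℝ) (u : ℝ → Measure (Ed d) → ℝ) : Prop :=
  ∀ t ∈ Set.Icc 0 T, ∀ m : Measure (Ed d), MemP d 2 m → ∀ ε > (0:ℝ), ∃ η > (0:ℝ),
    ∀ t' ∈ Set.Icc 0 T, ∀ m' : Measure (Ed d), MemP d 2 m' →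
      |t' - t| < η → wdist d 1 m m' < η → |u t' m' - u t m| < ε

/-- `u : [0,T] × 𝒫₂ → ℝ` is bounded. -/
def BddD1 (d : ℕ) (T : ℝ) (u : ℝ → Measure (Ed d) → ℝ) : Prop :=
  ∃ c : ℝ, ∀ t ∈ Set.Icc 0 T, ∀ m : Measure (Ed d), MemP d 2 m → |u t m| ≤ c

/-- The data of condition (A1) for a source term `F` : `F` is bounded and continuous, and
`δF/δm`, `∇_x(δF/δm)`, `∇²_x(δF/δm)` exist and are bounded and continuous. -/
structure A1Data (d : ℕ) (T : ℝ) where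
  /-- the source term `F(t,m)` -/
  F : ℝ → Measure (Ed d) → ℝ
  /-- the linear functional derivative `δF/δm (t,m,x)` -/
  δF : ℝ → Measure (Ed d) → Ed d → ℝ
  bddF : BddD1 d T F
  contF : ContD1 d T F
  measDeriv : ∀ t ∈ Set.Icc 0 T, ∀ m : Measure (Ed d), MemP d 2 m →
    ∀ m' : Measure (Ed d), MemP d 2 m' →
      Tendsto (fun r : ℝ =>
          (F t ((1 - ENNReal.ofReal r) • m + ENNReal.ofReal r • m') - F t m) / r)
        (𝓝[>] 0) (𝓝 (∫ x, δF t m x ∂m'))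
  normalized : ∀ t ∈ Set.Icc 0 T, ∀ m : Measure (Ed d), MemP d 2 m →
    ∫ x, δF t m x ∂m = 0
  smoothX : ∀ t ∈ Set.Icc 0 T, ∀ m : Measure (Ed d), MemP d 2 m → ContDiff ℝ 2 (δF t m)
  bddDeriv : ∃ c : ℝ, ∀ t ∈ Set.Icc 0 T, ∀ m : Measure (Ed d), MemP d 2 m → ∀ x : Ed d,
    |δF t m x| ≤ c ∧ ‖fderiv ℝ (δF t m) x‖ ≤ c ∧ ‖iteratedFDeriv ℝ 2 (δF t m) x‖ ≤ c
  contDeriv : ∀ t ∈ Set.Icc 0 T, ∀ m : Measure (Ed d), MemP d 2 m → ∀ x : Ed d,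
    ∀ ε > (0:ℝ), ∃ η > (0:ℝ), ∀ t' ∈ Set.Icc 0 T, ∀ m' : Measure (Ed d), MemP d 2 m' →
      ∀ x' : Ed d, |t' - t| < η → wdist d 1 m m' < η → ‖x' - x‖ < η →
        |δF t' m' x' - δF t m x| < ε ∧
          ‖fderiv ℝ (δF t' m') x' - fderiv ℝ (δF t m) x‖ < ε ∧
          ‖iteratedFDeriv ℝ 2 (δF t' m') x' - iteratedFDeriv ℝ 2 (δF t m) x‖ < ε

/-- The data of condition (A2) for a terminal condition `ψ` : `ψ` is continuous with at
most linear growth, and `δψ/δm`, `∇_x(δψ/δm)`, `∇²_x(δψ/δm)` exist, are continuous, and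
have linear growth in `x` uniformly in `m`. -/
structure A2Data (d : ℕ) where
  /-- the terminal condition `ψ(m)` -/
  ψ : Measure (Ed d) → ℝ
  /-- the linear functional derivative `δψ/δm (m,x)` -/
  δψ : Measure (Ed d) → Ed d → ℝ
  growth : ∃ c : ℝ, ∀ m : Measure (Ed d), MemP d 2 m → |ψ m| ≤ c * (1 + ∫ x, ‖x‖ ∂m)
  contψ : ∀ m : Measure (Ed d), MemP d 2 m → ∀ ε > (0:ℝ), ∃ η > (0:ℝ),
    ∀ m' : Measure (Ed d), MemP d 2 m' → wdist d 1 m m' < η → |ψ m' - ψ m| < ε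
  measDeriv : ∀ m : Measure (Ed d), MemP d 2 m → ∀ m' : Measure (Ed d), MemP d 2 m' →
    Tendsto (fun r : ℝ =>
        (ψ ((1 - ENNReal.ofReal r) • m + ENNReal.ofReal r • m') - ψ m) / r)
      (𝓝[>] 0) (𝓝 (∫ x, δψ m x ∂m'))
  normalized : ∀ m : Measure (Ed d), MemP d 2 m → ∫ x, δψ m x ∂m = 0
  smoothX : ∀ m : Measure (Ed d), MemP d 2 m → ContDiff ℝ 2 (δψ m)
  derivGrowth : ∃ c : ℝ, ∀ m : Measure (Ed d), MemP d 2 m → ∀ x : Ed d,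
    |δψ m x| ≤ c * (1 + ‖x‖) ∧ ‖fderiv ℝ (δψ m) x‖ ≤ c * (1 + ‖x‖) ∧
      ‖iteratedFDeriv ℝ 2 (δψ m) x‖ ≤ c * (1 + ‖x‖)
  contDeriv : ∀ m : Measure (Ed d), MemP d 2 m → ∀ x : Ed d, ∀ ε > (0:ℝ), ∃ η > (0:ℝ),
    ∀ m' : Measure (Ed d), MemP d 2 m' → ∀ x' : Ed d,
      wdist d 1 m m' < η → ‖x' - x‖ < η →
        |δψ m' x' - δψ m x| < ε ∧ ‖fderiv ℝ (δψ m') x' - fderiv ℝ (δψ m) x‖ < ε ∧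
          ‖iteratedFDeriv ℝ 2 (δψ m') x' - iteratedFDeriv ℝ 2 (δψ m) x‖ < ε

open ProbabilityTheory

lemma gaussDensity_nonneg (d : ℕ) {δ : ℝ} (hδ : 0 < δ) (x : Ed d) : 0 ≤ gaussDensity d δ x := by
  unfold gaussDensity; positivity

lemma integrable_gaussDensity (d : ℕ) {δ : ℝ} (hδ : 0 < δ) :
    Integrable (gaussDensity d δ) := by
  have h := GaussianFourier.integrable_cexp_neg_mul_sq_norm_add (V := Ed d)
    (b := ((1 / (2 * δ) : ℝ) : ℂ)) (by rw [Complex.ofReal_re]; positivity) 0 0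
  have h2 := (h.re).const_mul ((2 * Real.pi * δ) ^ (-(d : ℝ) / 2))
  refine h2.congr (Eventually.of_forall fun x => ?_)
  simp only [gaussDensity]
  congr 1
  have : (-((1 / (2 * δ) : ℝ) : ℂ) * (‖x‖ : ℂ) ^ 2 + 0 * ((inner ℝ (0 : Ed d) x : ℝ) : ℂ))
      = ((-‖x‖ ^ 2 / (2 * δ) : ℝ) : ℂ) := by
    push_cast; field_simp; simp
  rw [this]
  exact Complex.exp_ofReal_re _

lemma measurable_gaussDensity (d : ℕ) (δ : ℝ) : Measurable (gaussDensity d δ) := by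
  unfold gaussDensity; fun_prop

lemma isFiniteMeasure_gaussMeasure (d : ℕ) {δ : ℝ} (hδ : 0 < δ) :
    IsFiniteMeasure (gaussMeasure d δ) :=
  isFiniteMeasure_withDensity_ofReal (integrable_gaussDensity d hδ).2

lemma charFun_gaussMeasure (d : ℕ) {δ : ℝ} (hδ : 0 < δ) (w : Ed d) :
    charFun (gaussMeasure d δ) w = Complex.exp (-(δ * ‖w‖ ^ 2 / 2 : ℝ)) := by
  rw [charFun_apply, gaussMeasure, integral_withDensity_eq_integral_toReal_smul
    (measurable_gaussDensity d δ).ennreal_ofReal (by simp)]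
  have h := GaussianFourier.integral_cexp_neg_mul_sq_norm_add (V := Ed d)
    (b := ((1 / (2 * δ) : ℝ) : ℂ)) (by rw [Complex.ofReal_re]; positivity) Complex.I w
  have e : ∀ x : Ed d, (ENNReal.ofReal (gaussDensity d δ x)).toReal •
      Complex.exp ((inner ℝ x w : ℝ) * Complex.I) =
      (((2 * Real.pi * δ) ^ (-(d : ℝ) / 2) : ℝ) : ℂ) *
      Complex.exp (-((1 / (2 * δ) : ℝ) : ℂ) * (‖x‖ : ℂ) ^ 2
        + Complex.I * ((inner ℝ w x : ℝ) : ℂ)) := by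
    intro x
    rw [ENNReal.toReal_ofReal (gaussDensity_nonneg d hδ x), gaussDensity, Complex.real_smul,
      Complex.ofReal_mul, Complex.ofReal_exp, mul_assoc, ← Complex.exp_add, real_inner_comm]
    congr 3
    · push_cast; field_simp
    · ring
  simp_rw [e]
  rw [integral_const_mul, h, ← mul_assoc]
  have e1 : (Real.pi / ((1 / (2 * δ) : ℝ) : ℂ)) ^ (Module.finrank ℝ (Ed d) / 2 : ℂ)
      = (((2 * Real.pi * δ) ^ ((d : ℝ) / 2) : ℝ) : ℂ) := by
    rw [Complex.ofReal_cpow (by positivity)]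
    simp only [finrank_euclideanSpace, Fintype.card_fin]
    push_cast
    congr 1
    field_simp
  rw [e1, ← Complex.ofReal_mul, ← Real.rpow_add (by positivity)]
  have : -(d : ℝ) / 2 + d / 2 = 0 := by ring
  rw [this, Real.rpow_zero, Complex.ofReal_one, one_mul]
  congr 1
  push_cast
  rw [Complex.I_sq]
  have : (δ : ℂ) ≠ 0 := by exact_mod_cast hδ.ne'
  field_simp
  ring

lemma gaussMeasure_eq_map_stdGaussian (d : ℕ) {δ : ℝ} (hδ : 0 < δ) :
    gaussMeasure d δ = (stdGaussian (Ed d)).map (fun z => Real.sqrt δ • z) := by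
  have := isFiniteMeasure_gaussMeasure d hδ
  have : IsFiniteMeasure ((stdGaussian (Ed d)).map (fun z => Real.sqrt δ • z)) := by
    infer_instance
  refine Measure.ext_of_charFun (funext fun w => ?_)
  rw [charFun_gaussMeasure d hδ, charFun_map_smul, charFun_stdGaussian, norm_smul]
  congr 1
  rw [Real.norm_of_nonneg (Real.sqrt_nonneg _)]
  have hsq : ((Real.sqrt δ : ℝ) : ℂ) ^ 2 = δ := by
    rw [← Complex.ofReal_pow, Real.sq_sqrt hδ.le]
  push_cast
  rw [mul_pow, hsq]
  ring

/-- The law of `X + √h Z`, where `X` has law `m` and `Z` is an independent standard Gaussian. -/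
def gaussConv (d : ℕ) (h : ℝ) (m : Measure (Ed d)) : Measure (Ed d) :=
  (m.prod (stdGaussian (Ed d))).map fun q => q.1 + Real.sqrt h • q.2

lemma heatFlow_eq_gaussConv (d : ℕ) {t s : ℝ} (hts : t < s) (m : Measure (Ed d)) [SFinite m] :
    heatFlow d t s m = gaussConv d (s - t) m := by
  rw [heatFlow, if_neg (not_le.mpr hts), gaussMeasure_eq_map_stdGaussian d (sub_pos.mpr hts),
    gaussConv]
  conv_lhs => rw [← Measure.map_id (μ := m)]
  rw [Measure.map_prod_map _ _ measurable_id (by fun_prop),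
    Measure.map_map (by fun_prop) (by fun_prop)]
  rfl

lemma integrable_norm_pow_stdGaussian (d k : ℕ) :
    Integrable (fun z : Ed d => ‖z‖ ^ k) (stdGaussian (Ed d)) := by
  by_cases hk : k = 0
  · subst hk; simp
  have := (IsGaussian.memLp_id (stdGaussian (Ed d)) (k : ℝ≥0∞) (by simp)).integrable_norm_pow hk
  simpa using this

lemma integral_bilin_stdGaussian (d : ℕ) (B : Ed d →L[ℝ] Ed d →L[ℝ] ℝ) :
    ∫ z, B z z ∂(stdGaussian (Ed d)) =
      ∑ i, B (EuclideanSpace.single i 1) (EuclideanSpace.single i 1) := by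
  have hL := IsGaussian.memLp_id (stdGaussian (Ed d)) 2 (by simp)
  have hcov : ∀ i j : Fin d, ∫ z : Ed d, z i * z j ∂(stdGaussian (Ed d)) =
      if i = j then 1 else 0 := by
    intro i j
    have h := covarianceBilin_apply hL (EuclideanSpace.single i (1 : ℝ))
      (EuclideanSpace.single j (1 : ℝ))
    rw [covarianceBilin_stdGaussian, innerSL_apply_apply ℝ] at h
    simp only [id_eq, integral_id_stdGaussian] at h
    simp only [EuclideanSpace.inner_single_left, map_one, one_mul, sub_zero] at h
    rw [← h]
    simp
  have hint : ∀ i j : Fin d, Integrable (fun z : Ed d => z i * z j) (stdGaussian (Ed d)) := by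
    intro i j
    refine (integrable_norm_pow_stdGaussian d 2).mono' (by fun_prop)
      (Eventually.of_forall fun z => ?_)
    rw [norm_mul, sq]
    exact mul_le_mul (PiLp.norm_apply_le z i) (PiLp.norm_apply_le z j) (norm_nonneg _)
      (norm_nonneg _)
  have hexp : ∀ z : Ed d, B z z = ∑ i, ∑ j, (z i * z j) *
      B (EuclideanSpace.single i 1) (EuclideanSpace.single j 1) := by
    intro z
    have hz : z = ∑ i, z i • EuclideanSpace.single i (1 : ℝ) := by
      have := (EuclideanSpace.basisFun (Fin d) ℝ).sum_repr z
      simpa using this.symm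
    conv_lhs => rw [hz]
    simp only [map_sum, map_smul, _root_.sum_apply, _root_.smul_apply,
      smul_eq_mul, Finset.mul_sum]
    rw [Finset.sum_comm]
    refine Finset.sum_congr rfl fun i _ => Finset.sum_congr rfl fun j _ => by ring
  simp_rw [hexp]
  rw [integral_finsetSum _ fun i _ => integrable_finsetSum _ fun j _ => (hint i j).mul_const _]
  refine Finset.sum_congr rfl fun i _ => ?_
  rw [integral_finsetSum _ fun j _ => (hint i j).mul_const _]
  simp_rw [integral_mul_const, hcov]
  simp

lemma memP_two_iff {d : ℕ} {m : Measure (Ed d)} :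
    MemP d 2 m ↔ IsProbabilityMeasure m ∧ Integrable (fun x => ‖x‖ ^ 2) m := by
  simp only [MemP, Real.rpow_two]

lemma wdist_two_le {d : ℕ} {γ : Measure (Ed d × Ed d)} [IsProbabilityMeasure γ]
    {m m' : Measure (Ed d)} (h : IsCoupling d γ m m') :
    wdist d 2 m m' ≤ Real.sqrt (∫ q, ‖q.1 - q.2‖ ^ 2 ∂γ) := by
  refine csInf_le ⟨0, ?_⟩ ⟨γ, inferInstance, h, ?_⟩
  · rintro c ⟨γ', -, -, rfl⟩
    exact Real.rpow_nonneg (integral_nonneg fun q => Real.rpow_nonneg (norm_nonneg _) _) _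
  · rw [Real.sqrt_eq_rpow]
    simp only [Real.rpow_two]

/-- The convex combination `(1 - r) m + r p`. -/
def mix {d : ℕ} (m p : Measure (Ed d)) (r : ℝ) : Measure (Ed d) :=
  (1 - ENNReal.ofReal r) • m + ENNReal.ofReal r • p

lemma mix_eq {d : ℕ} (m p : Measure (Ed d)) {r : ℝ} (hr : 0 ≤ r) :
    mix m p r = ENNReal.ofReal (1 - r) • m + ENNReal.ofReal r • p := by
  rw [mix, ENNReal.ofReal_sub _ hr, ENNReal.ofReal_one]

lemma mix_zero {d : ℕ} (m p : Measure (Ed d)) : mix m p 0 = m := by simp [mix]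

lemma mix_one {d : ℕ} (m p : Measure (Ed d)) : mix m p 1 = p := by simp [mix]

lemma mix_one_sub {d : ℕ} (m p : Measure (Ed d)) {r : ℝ} (hr : r ∈ Icc (0 : ℝ) 1) :
    mix p m (1 - r) = mix m p r := by
  rw [mix_eq _ _ (sub_nonneg.mpr hr.2), mix_eq _ _ hr.1, sub_sub_cancel, add_comm]

lemma mix_mix {d : ℕ} (m p : Measure (Ed d)) {r e : ℝ} (hr : r ∈ Icc (0 : ℝ) 1)
    (he : e ∈ Icc (0 : ℝ) 1) : mix (mix m p r) p e = mix m p (r + e * (1 - r)) := by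
  have h1 := sub_nonneg.mpr hr.2
  have h2 := sub_nonneg.mpr he.2
  rw [mix_eq _ _ he.1, mix_eq _ _ hr.1,
    mix_eq _ _ (add_nonneg hr.1 (mul_nonneg he.1 h1)), smul_add, smul_smul, smul_smul,
    ← ENNReal.ofReal_mul h2, ← ENNReal.ofReal_mul h2, add_assoc, ← add_smul,
    ← ENNReal.ofReal_add (mul_nonneg h2 hr.1) he.1]
  congr 3 <;> ring

lemma integral_mix {d : ℕ} {m p : Measure (Ed d)} {r : ℝ} (hr : r ∈ Icc (0 : ℝ) 1)
    {f : Ed d → ℝ} (hm : Integrable f m) (hp : Integrable f p) :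
    ∫ x, f x ∂(mix m p r) = (1 - r) * ∫ x, f x ∂m + r * ∫ x, f x ∂p := by
  rw [mix_eq _ _ hr.1, integral_add_measure (hm.smul_measure ENNReal.ofReal_ne_top)
    (hp.smul_measure ENNReal.ofReal_ne_top), integral_smul_measure, integral_smul_measure,
    ENNReal.toReal_ofReal hr.1, ENNReal.toReal_ofReal (sub_nonneg.mpr hr.2), smul_eq_mul,
    smul_eq_mul]

lemma memP_mix {d : ℕ} {m p : Measure (Ed d)} (hm : MemP d 2 m) (hp : MemP d 2 p) {r : ℝ}
    (hr : r ∈ Icc (0 : ℝ) 1) : MemP d 2 (mix m p r) := by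
  have := hm.1
  have := hp.1
  rw [mix_eq _ _ hr.1]
  refine ⟨⟨?_⟩, (hm.2.smul_measure ENNReal.ofReal_ne_top).add_measure
    (hp.2.smul_measure ENNReal.ofReal_ne_top)⟩
  simp only [Measure.add_apply, Measure.smul_apply, measure_univ, smul_eq_mul, mul_one]
  rw [← ENNReal.ofReal_add (sub_nonneg.mpr hr.2) hr.1]
  simp

lemma IsCoupling.swap {d : ℕ} {γ : Measure (Ed d × Ed d)} {m p : Measure (Ed d)}
    (h : IsCoupling d γ m p) : IsCoupling d (γ.map Prod.swap) p m := by
  constructor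
  · rw [Measure.map_map measurable_fst measurable_swap]; exact h.2
  · rw [Measure.map_map measurable_snd measurable_swap]; exact h.1

lemma wdist_mix_le_of_le {d : ℕ} {γ : Measure (Ed d × Ed d)} [IsProbabilityMeasure γ]
    {m p : Measure (Ed d)} (hc : IsCoupling d γ m p)
    (hγ : Integrable (fun q : Ed d × Ed d => ‖q.1 - q.2‖ ^ 2) γ)
    {r s : ℝ} (hr : 0 ≤ r) (hrs : r ≤ s) (hs : s ≤ 1) :
    wdist d 2 (mix m p r) (mix m p s) ≤ Real.sqrt ((s - r) * ∫ q, ‖q.1 - q.2‖ ^ 2 ∂γ) := by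
  have hm : IsProbabilityMeasure m := hc.1 ▸ Measure.isProbabilityMeasure_map (by fun_prop)
  have hp : IsProbabilityMeasure p := hc.2 ▸ Measure.isProbabilityMeasure_map (by fun_prop)
  have h1 : (0 : ℝ) ≤ 1 - s := sub_nonneg.mpr hs
  have h2 : 0 ≤ s - r := sub_nonneg.mpr hrs
  have hdiag : Measurable (fun x : Ed d => (x, x)) := by fun_prop
  let Γ : Measure (Ed d × Ed d) := ENNReal.ofReal (1 - s) • m.map (fun x => (x, x)) +
    ENNReal.ofReal r • p.map (fun x => (x, x)) + ENNReal.ofReal (s - r) • γ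
  have hΓc : IsCoupling d Γ (mix m p r) (mix m p s) := by
    constructor
    · simp only [Γ]
      rw [Measure.map_add _ _ measurable_fst, Measure.map_add _ _ measurable_fst,
        Measure.map_smul, Measure.map_smul, Measure.map_smul,
        Measure.map_map measurable_fst hdiag, Measure.map_map measurable_fst hdiag, hc.1,
        mix_eq _ _ hr, show (1 : ℝ) - r = (1 - s) + (s - r) by ring, ENNReal.ofReal_add h1 h2,
        add_smul]
      simp only [Function.comp_def, Measure.map_id']
      abel
    · simp only [Γ]
      rw [Measure.map_add _ _ measurable_snd, Measure.map_add _ _ measurable_snd,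
        Measure.map_smul, Measure.map_smul, Measure.map_smul,
        Measure.map_map measurable_snd hdiag, Measure.map_map measurable_snd hdiag, hc.2,
        mix_eq _ _ (hr.trans hrs)]
      conv_rhs => rw [show s = r + (s - r) by ring, ENNReal.ofReal_add hr h2, add_smul]
      simp only [Function.comp_def, Measure.map_id', add_sub_cancel]
      abel
  have : IsProbabilityMeasure Γ := by
    have := (memP_mix (d := d) (m := Measure.dirac 0) (p := Measure.dirac 0)
      ⟨inferInstance, by simp [integrable_dirac]⟩ ⟨inferInstance, by simp [integrable_dirac]⟩
      ⟨hr, hrs.trans hs⟩).1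
    refine ⟨?_⟩
    have hd : ∀ μ : Measure (Ed d), IsProbabilityMeasure μ →
        IsProbabilityMeasure (μ.map (fun x => (x, x))) :=
      fun μ _ => Measure.isProbabilityMeasure_map hdiag.aemeasurable
    have := hd m hm
    have := hd p hp
    simp only [Γ, Measure.add_apply, Measure.smul_apply, measure_univ, smul_eq_mul, mul_one]
    rw [← ENNReal.ofReal_add h1 hr, ← ENNReal.ofReal_add (add_nonneg h1 hr) h2]
    simp
  have hd0 : ∀ μ : Measure (Ed d), Integrable (fun q : Ed d × Ed d => ‖q.1 - q.2‖ ^ 2)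
      (μ.map (fun x => (x, x))) := by
    intro μ
    rw [integrable_map_measure (by fun_prop) hdiag.aemeasurable]
    simp [Function.comp_def]
  have hi0 : ∀ μ : Measure (Ed d),
      ∫ q, ‖q.1 - q.2‖ ^ 2 ∂(μ.map (fun x => (x, x))) = 0 := by
    intro μ
    rw [integral_map hdiag.aemeasurable (by fun_prop)]
    simp
  refine (wdist_two_le hΓc).trans (le_of_eq ?_)
  congr 1
  simp only [Γ]
  have i1 := (hd0 m).smul_measure (c := ENNReal.ofReal (1 - s)) ENNReal.ofReal_ne_top
  have i2 := (hd0 p).smul_measure (c := ENNReal.ofReal r) ENNReal.ofReal_ne_top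
  rw [integral_add_measure (i1.add_measure i2) (hγ.smul_measure ENNReal.ofReal_ne_top),
    integral_add_measure i1 i2, integral_smul_measure, integral_smul_measure,
    integral_smul_measure, hi0, hi0, ENNReal.toReal_ofReal h2]
  simp

lemma wdist_mix_le {d : ℕ} {γ : Measure (Ed d × Ed d)} [IsProbabilityMeasure γ]
    {m p : Measure (Ed d)} (hc : IsCoupling d γ m p)
    (hγ : Integrable (fun q : Ed d × Ed d => ‖q.1 - q.2‖ ^ 2) γ)
    {r s : ℝ} (hr : r ∈ Icc (0 : ℝ) 1) (hs : s ∈ Icc (0 : ℝ) 1) :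
    wdist d 2 (mix m p r) (mix m p s) ≤ Real.sqrt (|s - r| * ∫ q, ‖q.1 - q.2‖ ^ 2 ∂γ) := by
  rcases le_total r s with h | h
  · rw [abs_of_nonneg (sub_nonneg.mpr h)]
    exact wdist_mix_le_of_le hc hγ hr.1 h hs.2
  · have : IsProbabilityMeasure (γ.map Prod.swap) :=
      Measure.isProbabilityMeasure_map measurable_swap.aemeasurable
    have e : (fun q : Ed d × Ed d => ‖q.1 - q.2‖ ^ 2) ∘ Prod.swap =
        fun q => ‖q.1 - q.2‖ ^ 2 := by
      funext q; simp [norm_sub_rev]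
    have key := wdist_mix_le_of_le hc.swap (by
      rw [integrable_map_measure (by fun_prop) measurable_swap.aemeasurable, e]
      exact hγ) (sub_nonneg.mpr hr.2) (sub_le_sub_left h 1) (by linarith [hs.1])
    rw [mix_one_sub _ _ hr, mix_one_sub _ _ hs,
      integral_map measurable_swap.aemeasurable (by fun_prop)] at key
    have e' : ∀ q : Ed d × Ed d, ‖q.swap.1 - q.swap.2‖ ^ 2 = ‖q.1 - q.2‖ ^ 2 :=
      fun q => congrFun e q
    simp_rw [e'] at key
    rw [abs_of_nonpos (sub_nonpos.mpr h)]
    convert key using 3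
    ring

/-- The natural coupling of `m` and its Gaussian convolution. -/
def gaussCoupling (d : ℕ) (h : ℝ) (m : Measure (Ed d)) : Measure (Ed d × Ed d) :=
  (m.prod (stdGaussian (Ed d))).map fun q => (q.1, q.1 + Real.sqrt h • q.2)

instance (d : ℕ) (h : ℝ) (m : Measure (Ed d)) [IsProbabilityMeasure m] :
    IsProbabilityMeasure (gaussCoupling d h m) :=
  Measure.isProbabilityMeasure_map (by fun_prop)

lemma isCoupling_gaussCoupling (d : ℕ) (h : ℝ) (m : Measure (Ed d)) [IsProbabilityMeasure m] :
    IsCoupling d (gaussCoupling d h m) m (gaussConv d h m) := by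
  constructor
  · rw [gaussCoupling, Measure.map_map measurable_fst (by fun_prop)]
    have : Prod.fst ∘ (fun q : Ed d × Ed d => (q.1, q.1 + Real.sqrt h • q.2)) = Prod.fst := rfl
    rw [this]
    simp
  · rw [gaussCoupling, Measure.map_map measurable_snd (by fun_prop)]
    rfl

lemma integrable_cost_gaussCoupling (d : ℕ) (h : ℝ) (m : Measure (Ed d))
    [IsProbabilityMeasure m] :
    Integrable (fun q : Ed d × Ed d => ‖q.1 - q.2‖ ^ 2) (gaussCoupling d h m) := by
  rw [gaussCoupling, integrable_map_measure (by fun_prop) (by fun_prop)]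
  have := ((integrable_norm_pow_stdGaussian d 2).comp_snd m).const_mul (Real.sqrt h ^ 2)
  refine this.congr (Eventually.of_forall fun q => ?_)
  simp [norm_smul, mul_pow]

lemma cost_gaussCoupling (d : ℕ) {h : ℝ} (hh : 0 ≤ h) (m : Measure (Ed d))
    [IsProbabilityMeasure m] :
    ∫ q, ‖q.1 - q.2‖ ^ 2 ∂(gaussCoupling d h m) = h * ∫ z, ‖z‖ ^ 2 ∂(stdGaussian (Ed d)) := by
  rw [gaussCoupling, integral_map (by fun_prop) (by fun_prop)]
  have : ∀ q : Ed d × Ed d, ‖q.1 - (q.1 + Real.sqrt h • q.2)‖ ^ 2 = h * ‖q.2‖ ^ 2 := by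
    intro q
    rw [sub_add_cancel_left, norm_neg, norm_smul, mul_pow,
      Real.norm_of_nonneg (Real.sqrt_nonneg _), Real.sq_sqrt hh]
  simp_rw [this]
  rw [integral_const_mul, integral_fun_snd (f := fun z : Ed d => ‖z‖ ^ 2)]
  simp

lemma wdist_mix_gaussConv_le (d : ℕ) {h : ℝ} (hh : 0 ≤ h) (m : Measure (Ed d))
    [IsProbabilityMeasure m] {r : ℝ} (hr : r ∈ Icc (0 : ℝ) 1) :
    wdist d 2 m (mix m (gaussConv d h m) r) ≤
      Real.sqrt (h * ∫ z, ‖z‖ ^ 2 ∂(stdGaussian (Ed d))) := by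
  have key := wdist_mix_le (isCoupling_gaussCoupling d h m)
    (integrable_cost_gaussCoupling d h m) (left_mem_Icc.mpr zero_le_one) hr
  rw [mix_zero, cost_gaussCoupling d hh] at key
  refine key.trans (Real.sqrt_le_sqrt ?_)
  rw [sub_zero, abs_of_nonneg hr.1]
  exact mul_le_of_le_one_left (mul_nonneg hh (integral_nonneg fun z => by positivity)) hr.2

lemma memP_gaussConv {d : ℕ} (h : ℝ) {m : Measure (Ed d)} (hm : MemP d 2 m) :
    MemP d 2 (gaussConv d h m) := by
  rw [memP_two_iff] at hm ⊢
  have := hm.1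
  refine ⟨Measure.isProbabilityMeasure_map (by fun_prop), ?_⟩
  rw [gaussConv, integrable_map_measure (by fun_prop) (by fun_prop)]
  have h1 := (hm.2.comp_fst (stdGaussian (Ed d))).const_mul 2
  have h2 := ((integrable_norm_pow_stdGaussian d 2).comp_snd m).const_mul (2 * Real.sqrt h ^ 2)
  refine (h1.add h2).mono' (by fun_prop) (Eventually.of_forall fun q => ?_)
  simp only [Function.comp_apply, Pi.add_apply]
  rw [Real.norm_of_nonneg (by positivity)]
  have := norm_add_le q.1 (Real.sqrt h • q.2)
  rw [norm_smul, Real.norm_of_nonneg (Real.sqrt_nonneg _)] at this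
  nlinarith [sq_nonneg (‖q.1‖ - Real.sqrt h * ‖q.2‖), norm_nonneg (q.1 + Real.sqrt h • q.2)]

lemma exists_taylor_two {E : Type*} [NormedAddCommGroup E] [NormedSpace ℝ E] {g : E → ℝ}
    (hg : ContDiff ℝ 2 g) (x z : E) (a : ℝ) :
    ∃ ξ ∈ Ioo (0 : ℝ) 1, g (x + a • z) - g x - a * fderiv ℝ g x z =
      a ^ 2 / 2 * iteratedFDeriv ℝ 2 g (x + (ξ * a) • z) (fun _ => z) := by
  have hline : ∀ u : ℝ, HasDerivAt (fun u : ℝ => x + (u * a) • z) (a • z) u := fun u => by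
    simpa using (((hasDerivAt_id u).mul_const a).smul_const z).const_add x
  have hg1 : Differentiable ℝ g := hg.differentiable (by norm_num)
  have hg2 : Differentiable ℝ (fderiv ℝ g) :=
    (hg.fderiv_right (m := 1) (by norm_num)).differentiable (by norm_num)
  have h1 : ∀ u : ℝ, HasDerivAt (fun u : ℝ => g (x + (u * a) • z))
      (fderiv ℝ g (x + (u * a) • z) (a • z)) u := fun u =>
    (hg1 _).hasFDerivAt.comp_hasDerivAt u (hline u)
  have h2 : ∀ u : ℝ, HasDerivAt (fun u : ℝ => fderiv ℝ g (x + (u * a) • z) (a • z))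
      (fderiv ℝ (fderiv ℝ g) (x + (u * a) • z) (a • z) (a • z)) u := fun u => by
    have := ((hg2 _).hasFDerivAt.comp_hasDerivAt u (hline u)).clm_apply (hasDerivAt_const u (a • z))
    simpa using this
  have hF : ∀ u : ℝ, HasDerivAt (fun u : ℝ => g (x + (u * a) • z) +
      fderiv ℝ g (x + (u * a) • z) (a • z) * (1 - u))
      (fderiv ℝ (fderiv ℝ g) (x + (u * a) • z) (a • z) (a • z) * (1 - u)) u := fun u => by
    refine ((h1 u).add ((h2 u).mul ((hasDerivAt_id u).const_sub 1))).congr_deriv ?_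
    simp
  have hG : ∀ u : ℝ, HasDerivAt (fun u : ℝ => (1 - u) ^ 2) (-(2 * (1 - u))) u := fun u => by
    refine (((hasDerivAt_id u).const_sub 1).pow 2).congr_deriv ?_
    simp
  obtain ⟨ξ, hξ, he⟩ := exists_ratio_hasDerivAt_eq_ratio_slope _ _ zero_lt_one
    (fun u _ => (hF u).continuousAt.continuousWithinAt) (fun u _ => hF u) _ _
    (fun u _ => (hG u).continuousAt.continuousWithinAt) (fun u _ => hG u)
  refine ⟨ξ, hξ, ?_⟩
  have hne : (1 - ξ) ≠ 0 := (sub_pos.mpr hξ.2).ne'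
  rw [iteratedFDeriv_two_apply]
  simp only [map_smul, _root_.smul_apply, smul_eq_mul, one_mul, zero_mul, zero_smul, add_zero] at he
  refine mul_right_cancel₀ hne ?_
  linear_combination (1 / 2) * he

lemma integrable_of_quadratic_growth {d : ℕ} {m : Measure (Ed d)} (hm : MemP d 2 m)
    {f : Ed d → ℝ} (hf : Continuous f) {c : ℝ} (hb : ∀ x, |f x| ≤ c * (1 + ‖x‖ ^ 2)) :
    Integrable f m := by
  rw [memP_two_iff] at hm
  have := hm.1
  exact (((integrable_const 1).add hm.2).const_mul c).mono' hf.aestronglyMeasurable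
    (Eventually.of_forall hb)

lemma integral_iteratedFDeriv_two_stdGaussian {d : ℕ} (g : Ed d → ℝ) (x : Ed d) :
    ∫ z, iteratedFDeriv ℝ 2 g x (fun _ => z) ∂(stdGaussian (Ed d)) = lapl d g x := by
  simp_rw [iteratedFDeriv_two_apply]
  rw [integral_bilin_stdGaussian]
  simp [lapl, iteratedFDeriv_two_apply]

lemma continuous_iteratedFDeriv_two_apply {d : ℕ} {g : Ed d → ℝ} (hg : ContDiff ℝ 2 g) :
    Continuous (fun q : Ed d × Ed d => iteratedFDeriv ℝ 2 g q.1 (fun _ => q.2)) := by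
  simp_rw [iteratedFDeriv_two_apply]
  have : Continuous (fderiv ℝ (fderiv ℝ g)) :=
    (hg.fderiv_right (m := 1) (by norm_num)).continuous_fderiv (by norm_num)
  fun_prop

lemma abs_iteratedFDeriv_two_apply_le {d : ℕ} {g : Ed d → ℝ} {x : Ed d} {C : ℝ}
    (h : ‖iteratedFDeriv ℝ 2 g x‖ ≤ C) (z : Ed d) :
    |iteratedFDeriv ℝ 2 g x (fun _ => z)| ≤ C * ‖z‖ ^ 2 := by
  have := (iteratedFDeriv ℝ 2 g x).le_opNorm (fun _ => z)
  rw [Real.norm_eq_abs, Finset.prod_const, Finset.card_univ, Fintype.card_fin] at this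
  exact this.trans (by gcongr)

lemma integral_iteratedFDeriv_two_prod {d : ℕ} {m : Measure (Ed d)} (hm : MemP d 2 m)
    {g : Ed d → ℝ} (hg : ContDiff ℝ 2 g) {c : ℝ}
    (hb : ∀ x, ‖iteratedFDeriv ℝ 2 g x‖ ≤ c * (1 + ‖x‖ ^ 2)) :
    ∫ q, iteratedFDeriv ℝ 2 g q.1 (fun _ => q.2) ∂(m.prod (stdGaussian (Ed d))) =
      ∫ x, lapl d g x ∂m := by
  have hm' := memP_two_iff.mp hm
  have := hm'.1
  have hint : Integrable (fun q : Ed d × Ed d => c * (1 + ‖q.1‖ ^ 2) * ‖q.2‖ ^ 2)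
      (m.prod (stdGaussian (Ed d))) :=
    (((integrable_const 1).add hm'.2).const_mul c).mul_prod (integrable_norm_pow_stdGaussian d 2)
  rw [integral_prod _ (hint.mono' (continuous_iteratedFDeriv_two_apply hg).aestronglyMeasurable
    (Eventually.of_forall fun q => abs_iteratedFDeriv_two_apply_le (hb q.1) q.2))]
  simp_rw [integral_iteratedFDeriv_two_stdGaussian]

lemma integral_gaussConv_sub {d : ℕ} {m : Measure (Ed d)} (hm : MemP d 2 m) (h : ℝ)
    {g : Ed d → ℝ} (hg : ContDiff ℝ 2 g) {c : ℝ} (hb0 : ∀ x, |g x| ≤ c * (1 + ‖x‖ ^ 2))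
    (hb1 : ∀ x, ‖fderiv ℝ g x‖ ≤ c * (1 + ‖x‖ ^ 2)) :
    ∫ x, g x ∂(gaussConv d h m) - ∫ x, g x ∂m =
      ∫ q, (g (q.1 + Real.sqrt h • q.2) - g q.1 - Real.sqrt h * fderiv ℝ g q.1 q.2)
        ∂(m.prod (stdGaussian (Ed d))) := by
  have hm' := memP_two_iff.mp hm
  have := hm'.1
  have hgc : Continuous g := hg.continuous
  have hdc : Continuous (fderiv ℝ g) := hg.continuous_fderiv (by norm_num)
  have i1 : Integrable (fun q : Ed d × Ed d => g (q.1 + Real.sqrt h • q.2))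
      (m.prod (stdGaussian (Ed d))) :=
    (integrable_map_measure hgc.aestronglyMeasurable (by fun_prop)).mp
      (integrable_of_quadratic_growth (memP_gaussConv h hm) hgc hb0)
  have i2 : Integrable (fun q : Ed d × Ed d => g q.1) (m.prod (stdGaussian (Ed d))) :=
    (integrable_of_quadratic_growth hm hgc hb0).comp_fst _
  have i3 : Integrable (fun q : Ed d × Ed d => fderiv ℝ g q.1 q.2)
      (m.prod (stdGaussian (Ed d))) := by
    have hint : Integrable (fun q : Ed d × Ed d => c * (1 + ‖q.1‖ ^ 2) * ‖q.2‖ ^ 1)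
        (m.prod (stdGaussian (Ed d))) :=
      (((integrable_const 1).add hm'.2).const_mul c).mul_prod
        (integrable_norm_pow_stdGaussian d 1)
    refine hint.mono' (by fun_prop) (Eventually.of_forall fun q => ?_)
    rw [pow_one]
    exact ((fderiv ℝ g q.1).le_opNorm q.2).trans (by gcongr; exact hb1 q.1)
  have z3 : ∫ q, fderiv ℝ g q.1 q.2 ∂(m.prod (stdGaussian (Ed d))) = 0 := by
    rw [integral_prod _ i3]
    simp_rw [integral_strongDual_stdGaussian]
    simp
  rw [integral_sub (f := fun q : Ed d × Ed d => g (q.1 + Real.sqrt h • q.2) - g q.1)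
    (i1.sub i2) (i3.const_mul _), integral_sub i1 i2, integral_const_mul, z3,
    integral_fun_fst (f := g), gaussConv,
    integral_map (by fun_prop) hgc.aestronglyMeasurable]
  simp

/-- A second order expansion of the heat semigroup, along a varying family of functions. -/
lemma tendsto_integral_gaussConv_sub_div {ι : Type*} {l : Filter ι} [l.IsCountablyGenerated]
    {d : ℕ} {m : Measure (Ed d)} (hm : MemP d 2 m) {h : ι → ℝ} (hh : Tendsto h l (𝓝[>] 0))
    {g : ι → Ed d → ℝ} {g₀ : Ed d → ℝ} {c : ℝ} (hg : ∀ᶠ a in l, ContDiff ℝ 2 (g a))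
    (hgb : ∀ᶠ a in l, ∀ x, |g a x| ≤ c * (1 + ‖x‖ ^ 2) ∧
      ‖fderiv ℝ (g a) x‖ ≤ c * (1 + ‖x‖ ^ 2) ∧
      ‖iteratedFDeriv ℝ 2 (g a) x‖ ≤ c * (1 + ‖x‖ ^ 2))
    (hg₀ : ContDiff ℝ 2 g₀) (hgb₀ : ∀ x, ‖iteratedFDeriv ℝ 2 g₀ x‖ ≤ c * (1 + ‖x‖ ^ 2))
    (hconv : ∀ x, ∀ ε > (0 : ℝ), ∃ η > (0 : ℝ), ∀ᶠ a in l, ∀ x', ‖x' - x‖ < η →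
      ‖iteratedFDeriv ℝ 2 (g a) x' - iteratedFDeriv ℝ 2 g₀ x‖ < ε) :
    Tendsto (fun a => (∫ x, g a x ∂(gaussConv d (h a) m) - ∫ x, g a x ∂m) / h a) l
      (𝓝 (1 / 2 * ∫ x, lapl d g₀ x ∂m)) := by
  have hm' := memP_two_iff.mp hm
  have := hm'.1
  have hc : 0 ≤ c := by
    have := (norm_nonneg _).trans (hgb₀ 0)
    simpa using this
  have hh0 : Tendsto h l (𝓝 0) := hh.mono_right nhdsWithin_le_nhds
  have hpos : ∀ᶠ a in l, 0 < h a := hh self_mem_nhdsWithin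
  have hle : ∀ᶠ a in l, h a ≤ 1 := hh0.eventually (eventually_le_nhds zero_lt_one)
  have hsqrt : Tendsto (fun a => Real.sqrt (h a)) l (𝓝 0) := by
    simpa [Function.comp_def] using (Real.continuous_sqrt.tendsto 0).comp hh0
  rw [← integral_iteratedFDeriv_two_prod hm hg₀ hgb₀, ← integral_const_mul]
  have hTaylor : ∀ a, 0 < h a → ContDiff ℝ 2 (g a) → ∀ q : Ed d × Ed d, ∃ ξ ∈ Ioo (0 : ℝ) 1,
      (g a (q.1 + Real.sqrt (h a) • q.2) - g a q.1 -
        Real.sqrt (h a) * fderiv ℝ (g a) q.1 q.2) / h a =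
      1 / 2 * iteratedFDeriv ℝ 2 (g a) (q.1 + (ξ * Real.sqrt (h a)) • q.2) (fun _ => q.2) := by
    intro a ha hga q
    obtain ⟨ξ, hξ, he⟩ := exists_taylor_two hga q.1 q.2 (Real.sqrt (h a))
    refine ⟨ξ, hξ, ?_⟩
    rw [he, Real.sq_sqrt ha.le]
    field_simp
  have hsmall : ∀ ξ ∈ Ioo (0 : ℝ) 1, ∀ a, ∀ z : Ed d,
      ‖(ξ * Real.sqrt (h a)) • z‖ ≤ Real.sqrt (h a) * ‖z‖ := by
    intro ξ hξ a z
    rw [norm_smul, Real.norm_of_nonneg (mul_nonneg hξ.1.le (Real.sqrt_nonneg _))]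
    gcongr
    exact mul_le_of_le_one_left (Real.sqrt_nonneg _) hξ.2.le
  have main : Tendsto (fun a => ∫ q, (g a (q.1 + Real.sqrt (h a) • q.2) - g a q.1 -
        Real.sqrt (h a) * fderiv ℝ (g a) q.1 q.2) / h a ∂(m.prod (stdGaussian (Ed d)))) l
      (𝓝 (∫ q, 1 / 2 * iteratedFDeriv ℝ 2 g₀ q.1 (fun _ => q.2)
        ∂(m.prod (stdGaussian (Ed d))))) := by
    refine tendsto_integral_filter_of_dominated_convergence
      (fun q => c * (1 + ‖q.1‖ ^ 2) * ‖q.2‖ ^ 2 + c * ‖q.2‖ ^ 4) ?_ ?_ ?_ ?_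
    · filter_upwards [hg] with a hga
      have h1 := hga.continuous
      have h2 : Continuous (fderiv ℝ (g a)) := hga.continuous_fderiv (by norm_num)
      exact Continuous.aestronglyMeasurable (by fun_prop)
    · filter_upwards [hg, hgb, hpos, hle] with a hga hgba ha ha1
      refine Eventually.of_forall fun q => ?_
      obtain ⟨ξ, hξ, he⟩ := hTaylor a ha hga q
      rw [he, norm_mul]
      have hb := abs_iteratedFDeriv_two_apply_le
        (hgba (q.1 + (ξ * Real.sqrt (h a)) • q.2)).2.2 q.2
      have hs := hsmall ξ hξ a q.2
      have hs1 : Real.sqrt (h a) * ‖q.2‖ ≤ ‖q.2‖ :=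
        mul_le_of_le_one_left (norm_nonneg _) (Real.sqrt_le_one.mpr ha1)
      have hn : ‖q.1 + (ξ * Real.sqrt (h a)) • q.2‖ ≤ ‖q.1‖ + ‖q.2‖ :=
        (norm_add_le _ _).trans (by linarith)
      have hn2 : ‖q.1 + (ξ * Real.sqrt (h a)) • q.2‖ ^ 2 ≤ 2 * ‖q.1‖ ^ 2 + 2 * ‖q.2‖ ^ 2 := by
        have := pow_le_pow_left₀ (norm_nonneg _) hn 2
        nlinarith [sq_nonneg (‖q.1‖ - ‖q.2‖)]
      calc ‖(1 / 2 : ℝ)‖ * ‖iteratedFDeriv ℝ 2 (g a) (q.1 + (ξ * Real.sqrt (h a)) • q.2)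
              (fun _ => q.2)‖
          ≤ 1 / 2 * (c * (1 + (2 * ‖q.1‖ ^ 2 + 2 * ‖q.2‖ ^ 2)) * ‖q.2‖ ^ 2) := by
            rw [Real.norm_of_nonneg (by norm_num), Real.norm_eq_abs]
            gcongr
            exact hb.trans (by gcongr)
        _ ≤ c * (1 + ‖q.1‖ ^ 2) * ‖q.2‖ ^ 2 + c * ‖q.2‖ ^ 4 := by
            have : 0 ≤ c * ‖q.2‖ ^ 2 := by positivity
            nlinarith
    · exact ((((integrable_const 1).add hm'.2).const_mul c).mul_prod
        (integrable_norm_pow_stdGaussian d 2)).add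
        (((integrable_norm_pow_stdGaussian d 4).comp_snd m).const_mul c)
    · refine Eventually.of_forall fun q => ?_
      rw [Metric.tendsto_nhds]
      intro ε hε
      obtain ⟨η, hη, hev⟩ := hconv q.1 (ε / (‖q.2‖ ^ 2 + 1)) (by positivity)
      have hz : Tendsto (fun a => Real.sqrt (h a) * ‖q.2‖) l (𝓝 0) := by
        simpa using hsqrt.mul_const ‖q.2‖
      filter_upwards [hg, hpos, hev, hz.eventually (eventually_lt_nhds hη)] with a hga ha hea hza
      obtain ⟨ξ, hξ, he⟩ := hTaylor a ha hga q
      have hd := hea (q.1 + (ξ * Real.sqrt (h a)) • q.2) (by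
        rw [add_sub_cancel_left]; exact (hsmall ξ hξ a q.2).trans_lt hza)
      rw [he, Real.dist_eq, ← mul_sub, abs_mul, ← _root_.sub_apply]
      have hb := (iteratedFDeriv ℝ 2 (g a) (q.1 + (ξ * Real.sqrt (h a)) • q.2) -
        iteratedFDeriv ℝ 2 g₀ q.1).le_opNorm (fun _ => q.2)
      rw [Real.norm_eq_abs, Finset.prod_const, Finset.card_univ, Fintype.card_fin] at hb
      have hb' := hb.trans (mul_le_mul_of_nonneg_right hd.le (by positivity))
      have : ε / (‖q.2‖ ^ 2 + 1) * ‖q.2‖ ^ 2 ≤ ε := by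
        rw [div_mul_eq_mul_div, div_le_iff₀ (by positivity)]
        nlinarith
      rw [abs_of_pos (by norm_num)]
      linarith
  refine main.congr' ?_
  filter_upwards [hg, hgb] with a hga hgba
  rw [integral_gaussConv_sub hm (h a) hga (fun x => (hgba x).1) (fun x => (hgba x).2.1),
    integral_div]

lemma tendsto_sqrt_cost (d : ℕ) :
    Tendsto (fun h => Real.sqrt (h * ∫ z, ‖z‖ ^ 2 ∂(stdGaussian (Ed d)))) (𝓝[>] 0) (𝓝 0) := by
  have : Continuous fun h => Real.sqrt (h * ∫ z, ‖z‖ ^ 2 ∂(stdGaussian (Ed d))) := by fun_prop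
  simpa using (this.tendsto 0).mono_left nhdsWithin_le_nhds

namespace TestFn

variable {d : ℕ} {T : ℝ} (ψ : TestFn d T)

lemma integrable_δφ {t : ℝ} (ht : t ∈ Ico 0 T) {m μ : Measure (Ed d)} (hm : MemP d 2 m)
    (hμ : MemP d 2 μ) : Integrable (ψ.δφ t m) μ := by
  obtain ⟨c, hc⟩ := ψ.quadGrowth
  exact integrable_of_quadratic_growth hμ (ψ.smoothX t ht m hm).continuous
    fun x => (hc t ht m hm x).1

lemma hasDerivWithinAt_mix {t : ℝ} (ht : t ∈ Ico 0 T) {m p : Measure (Ed d)}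
    (hm : MemP d 2 m) (hp : MemP d 2 p) {r : ℝ} (hr : r ∈ Ico (0 : ℝ) 1) :
    HasDerivWithinAt (fun r => ψ.φ t (mix m p r))
      (∫ x, ψ.δφ t (mix m p r) x ∂p - ∫ x, ψ.δφ t (mix m p r) x ∂m) (Ici r) r := by
  have hrc := Ico_subset_Icc_self hr
  have hmr := memP_mix hm hp hrc
  have h1 : 0 < 1 - r := sub_pos.mpr hr.2
  have hlim := ψ.measDeriv t ht _ hmr p hp
  have hnorm := ψ.normalized t ht _ hmr
  rw [integral_mix hrc (ψ.integrable_δφ ht hmr hm) (ψ.integrable_δφ ht hmr hp)] at hnorm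
  rw [← hasDerivWithinAt_Ioi_iff_Ici, hasDerivWithinAt_iff_tendsto_slope' self_notMem_Ioi]
  have hu : Tendsto (fun y => (y - r) / (1 - r)) (𝓝[>] r) (𝓝[>] 0) := by
    refine tendsto_nhdsWithin_iff.mpr ⟨?_, ?_⟩
    · have : Continuous fun y : ℝ => (y - r) / (1 - r) := by fun_prop
      simpa using (this.tendsto r).mono_left nhdsWithin_le_nhds
    · filter_upwards [self_mem_nhdsWithin] with y hy
      exact div_pos (sub_pos.mpr hy) h1
  have hval : ∫ x, ψ.δφ t (mix m p r) x ∂p - ∫ x, ψ.δφ t (mix m p r) x ∂m =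
      (∫ x, ψ.δφ t (mix m p r) x ∂p) / (1 - r) := by
    rw [eq_div_iff h1.ne']
    linear_combination -hnorm
  rw [hval]
  refine ((hlim.comp hu).div_const (1 - r)).congr' ?_
  filter_upwards [Ioo_mem_nhdsGT hr.2] with y hy
  have he : (y - r) / (1 - r) ∈ Icc (0 : ℝ) 1 :=
    ⟨div_nonneg (sub_nonneg.mpr hy.1.le) h1.le, (div_le_one h1).mpr (by linarith [hy.2])⟩
  have hmm := mix_mix m p hrc he
  rw [div_mul_cancel₀ _ h1.ne', add_sub_cancel] at hmm
  simp only [Function.comp_apply]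
  rw [← mix, hmm, slope_def_field, div_div, div_mul_cancel₀ _ h1.ne']

lemma continuousOn_mix {t : ℝ} (ht : t ∈ Icc 0 T) {γ : Measure (Ed d × Ed d)}
    [IsProbabilityMeasure γ] {m p : Measure (Ed d)} (hm : MemP d 2 m) (hp : MemP d 2 p)
    (hc : IsCoupling d γ m p) (hγ : Integrable (fun q : Ed d × Ed d => ‖q.1 - q.2‖ ^ 2) γ) :
    ContinuousOn (fun r => ψ.φ t (mix m p r)) (Icc 0 1) := by
  intro r hr
  rw [ContinuousWithinAt, Metric.tendsto_nhds]
  intro ε hε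
  obtain ⟨η, hη, h⟩ := ψ.d2cont t ht _ (memP_mix hm hp hr) ε hε
  have hlim : Tendsto (fun s => Real.sqrt (|s - r| * ∫ q, ‖q.1 - q.2‖ ^ 2 ∂γ))
      (𝓝[Icc 0 1] r) (𝓝 0) := by
    have : Continuous fun s => Real.sqrt (|s - r| * ∫ q, ‖q.1 - q.2‖ ^ 2 ∂γ) := by fun_prop
    simpa using (this.tendsto r).mono_left nhdsWithin_le_nhds
  filter_upwards [self_mem_nhdsWithin, hlim.eventually (eventually_lt_nhds hη)] with s hs hsη
  exact h t ht _ (memP_mix hm hp hs) (by simpa using hη)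
    ((wdist_mix_le hc hγ hr hs).trans_lt hsη)

lemma abs_sub_sub_le_of_mix {t : ℝ} (ht : t ∈ Ico 0 T) {γ : Measure (Ed d × Ed d)}
    [IsProbabilityMeasure γ] {m p : Measure (Ed d)} (hm : MemP d 2 m) (hp : MemP d 2 p)
    (hc : IsCoupling d γ m p) (hγ : Integrable (fun q : Ed d × Ed d => ‖q.1 - q.2‖ ^ 2) γ)
    {L ε : ℝ} (hb : ∀ r ∈ Ico (0 : ℝ) 1,
      |∫ x, ψ.δφ t (mix m p r) x ∂p - ∫ x, ψ.δφ t (mix m p r) x ∂m - L| ≤ ε) :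
    |ψ.φ t p - ψ.φ t m - L| ≤ ε := by
  have key := norm_image_sub_le_of_norm_deriv_right_le_segment
    (f := fun r => ψ.φ t (mix m p r) - r * L) (a := 0) (b := 1) (C := ε)
    ((ψ.continuousOn_mix (Ico_subset_Icc_self ht) hm hp hc hγ).sub (by fun_prop))
    (fun r hr => (ψ.hasDerivWithinAt_mix ht hm hp hr).sub
      ((hasDerivWithinAt_id r _).mul_const L))
    (fun r hr => by rw [one_mul]; exact hb r hr) 1 (right_mem_Icc.mpr zero_le_one)
  simp only [mix_one, mix_zero, one_mul, zero_mul, sub_zero, mul_one, Real.norm_eq_abs] at key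
  rwa [sub_right_comm] at key

lemma tendsto_gaussConv_div {t : ℝ} (ht : t ∈ Ico 0 T) {m : Measure (Ed d)}
    (hm : MemP d 2 m) :
    Tendsto (fun h => (ψ.φ t (gaussConv d h m) - ψ.φ t m) / h) (𝓝[>] 0)
      (𝓝 (1 / 2 * ∫ x, lapl d (ψ.δφ t m) x ∂m)) := by
  have := hm.1
  obtain ⟨c, hc⟩ := ψ.quadGrowth
  have hmem : ∀ h, ∀ r ∈ Ico (0 : ℝ) 1, MemP d 2 (mix m (gaussConv d h m) r) :=
    fun h r hr => memP_mix hm (memP_gaussConv h hm) (Ico_subset_Icc_self hr)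
  have hlim := tendsto_integral_gaussConv_sub_div
    (l := 𝓝[>] (0 : ℝ) ×ˢ 𝓟 (Ico (0 : ℝ) 1)) (h := Prod.fst)
    (g := fun a => ψ.δφ t (mix m (gaussConv d a.1 m) a.2)) (c := c) hm tendsto_fst
    (eventually_prod_principal_iff.mpr <| Eventually.of_forall fun h r hr =>
      ψ.smoothX t ht _ (hmem h r hr))
    (eventually_prod_principal_iff.mpr <| Eventually.of_forall fun h r hr x =>
      hc t ht _ (hmem h r hr) x)
    (ψ.smoothX t ht m hm) (fun x => (hc t ht m hm x).2.2) (by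
      intro x ε hε
      obtain ⟨η, hη, hcont⟩ := ψ.d2contDeriv t ht m hm x ε hε
      refine ⟨η, hη, eventually_prod_principal_iff.mpr ?_⟩
      filter_upwards [self_mem_nhdsWithin,
        (tendsto_sqrt_cost d).eventually (eventually_lt_nhds hη)] with h hh hhη r hr x' hx'
      exact (hcont t ht _ (hmem h r hr) x' (by simpa using hη)
        ((wdist_mix_gaussConv_le d (le_of_lt hh) m (Ico_subset_Icc_self hr)).trans_lt hhη)
        hx').2.2.2)
  rw [Metric.tendsto_nhds]
  intro ε hε
  have hev := eventually_prod_principal_iff.mp (Metric.tendsto_nhds.mp hlim (ε / 2) (half_pos hε))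
  filter_upwards [self_mem_nhdsWithin, hev] with h hh hb
  have hh : 0 < h := hh
  have key := ψ.abs_sub_sub_le_of_mix ht hm (memP_gaussConv h hm)
    (isCoupling_gaussCoupling d h m) (integrable_cost_gaussCoupling d h m)
    (L := h * (1 / 2 * ∫ x, lapl d (ψ.δφ t m) x ∂m)) (ε := h * (ε / 2)) (by
      intro r hr
      have := (hb r hr).le
      rwa [Real.dist_eq, div_sub' hh.ne', abs_div, abs_of_pos hh, div_le_iff₀' hh] at this)
  rw [Real.dist_eq, div_sub' hh.ne', abs_div, abs_of_pos hh, div_lt_iff₀' hh]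
  exact key.trans_lt (mul_lt_mul_of_pos_left (half_lt_self hε) hh)

lemma tendsto_time_div {t : ℝ} (ht : t ∈ Ico 0 T) {m : Measure (Ed d)} (hm : MemP d 2 m)
    {p : ℝ → Measure (Ed d)} (hp : ∀ s, MemP d 2 (p s))
    (hlim : ∀ η > (0 : ℝ), ∀ᶠ s in 𝓝[>] t, wdist d 2 m (p s) < η) :
    Tendsto (fun s => (ψ.φ s (p s) - ψ.φ t (p s)) / (s - t)) (𝓝[>] t) (𝓝 (ψ.φt t m)) := by
  rw [Metric.tendsto_nhds]
  intro ε hε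
  obtain ⟨η, hη, hcont⟩ := ψ.d2contDeriv t ht m hm 0 ε hε
  filter_upwards [Ioo_mem_nhdsGT ht.2, Ioo_mem_nhdsGT (lt_add_of_pos_right t hη), hlim η hη]
    with s hsT hsη hs
  have hder := ψ.timeDeriv (p s) (hp s)
  obtain ⟨ξ, hξ, he⟩ := exists_hasDerivAt_eq_slope (fun u => ψ.φ u (p s))
    (fun u => ψ.φt u (p s)) hsT.1
    (fun u hu => (hder u ⟨ht.1.trans hu.1, hu.2.trans_lt hsT.2⟩).continuousWithinAt.mono
      (Icc_subset_Icc ht.1 hsT.2.le))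
    (fun u hu => (hder u ⟨ht.1.trans hu.1.le, hu.2.trans hsT.2⟩).hasDerivAt
      (Icc_mem_nhds (ht.1.trans_lt hu.1) (hu.2.trans hsT.2)))
  rw [← he]
  exact (hcont ξ ⟨ht.1.trans hξ.1.le, hξ.2.trans hsT.2⟩ (p s) (hp s) 0
    (by rw [abs_of_pos (sub_pos.mpr hξ.1)]; linarith [hξ.2, hsη.2]) hs (by simpa using hη)).1

end TestFn

/-- If `φ` satisfies condition (A3), then for all `(t,m) ∈ [0,T) × 𝒫₂`
the map `s ↦ φ(s, p^{t,m}_s)` is right-differentiable at `s = t` with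
`lim_{s↓t} (φ(s,p^{t,m}_s) − φ(t,m))/(s−t) = ∂_t φ(t,m) + ½ ∫ div[D_m φ](t,m,x) dm(x)`. -/
theorem testFn_deriv_along_heatFlow (d : ℕ) (T : ℝ) (hT : 0 < T)
    (ψ : TestFn d T) (t : ℝ) (ht : t ∈ Set.Ico 0 T)
    (m : Measure (Ed d)) (hm : MemP d 2 m) :
    Tendsto (fun s => (ψ.φ s (heatFlow d t s m) - ψ.φ t m) / (s - t))
      (𝓝[Set.Ioc t T] t)
      (𝓝 (ψ.φt t m + (1 / 2) * ∫ x, lapl d (ψ.δφ t m) x ∂m)) := by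
  have := hm.1
  have hsub : Tendsto (fun s => s - t) (𝓝[>] t) (𝓝[>] 0) := by
    refine tendsto_nhdsWithin_iff.mpr ⟨?_, ?_⟩
    · have : Continuous fun s : ℝ => s - t := by fun_prop
      simpa using (this.tendsto t).mono_left nhdsWithin_le_nhds
    · filter_upwards [self_mem_nhdsWithin] with s hs
      exact sub_pos.mpr (mem_Ioi.mp hs)
  have hdist : ∀ η > (0 : ℝ), ∀ᶠ s in 𝓝[>] t, wdist d 2 m (gaussConv d (s - t) m) < η := by
    intro η hη
    refine hsub.eventually (p := fun h => wdist d 2 m (gaussConv d h m) < η) ?_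
    filter_upwards [self_mem_nhdsWithin,
      (tendsto_sqrt_cost d).eventually (eventually_lt_nhds hη)] with h hh hhη
    have := wdist_mix_gaussConv_le d (le_of_lt hh) m (right_mem_Icc.mpr zero_le_one)
    rw [mix_one] at this
    exact this.trans_lt hhη
  have htime := ψ.tendsto_time_div ht hm (p := fun s => gaussConv d (s - t) m)
    (fun s => memP_gaussConv _ hm) hdist
  have hspace := (ψ.tendsto_gaussConv_div ht hm).comp hsub
  refine ((htime.add hspace).congr' ?_).mono_left (nhdsWithin_mono t Ioc_subset_Ioi_self)
  filter_upwards [self_mem_nhdsWithin] with s hs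
  rw [heatFlow_eq_gaussConv d hs, Function.comp_apply, ← add_div, sub_add_sub_cancel]

end
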